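/- Let G be a nontrivial finite group and Y a nonempty subset of G. Then Y is a pre-difference set in G (i.e., λ_{[a]}(Y)/#[a] is independent of the choice of a ∈ G with a ≠ 1) if and only if D(Y) = √((1/#Y − 1/#G)/(#G − 1)). -/

import Mathlib

open Finset CategoryTheory

/-- The conjugacy class `[a]` of `a`, as a finset. -/
noncomputable def conjCl {G : Type} [Group G] [Fintype G] (a : G) : Finset G :=
  letI := Classical.decPred (IsConj a)
  Finset.univ.filter (fun b => IsConj a b)

/-- `λ_{[a]}(Y) = #{(x,y) ∈ Y×Y : x⁻¹y ∈ [a]}`. -/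
noncomputable def lamConj {G : Type} [Group G] [Fintype G] (Y : Finset G) (a : G) : ℕ :=
  letI := Classical.decPred fun p : G × G => IsConj a (p.1⁻¹ * p.2)
  ((Y ×ˢ Y).filter (fun p => IsConj a (p.1⁻¹ * p.2))).card

/-- `∂_ρ(Y) = √( (dim ρ)/((#Y)²·#G) · ∑_{x,y ∈ Y} χ_ρ(x⁻¹y) )`. -/
noncomputable def dPar {G : Type} [Group G] [Fintype G] (V : FDRep ℂ G) (Y : Finset G) : ℝ :=
  Real.sqrt ((Module.finrank ℂ V : ℝ) / ((Y.card : ℝ) ^ 2 * (Fintype.card G : ℝ)) *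
    (∑ x ∈ Y, ∑ y ∈ Y, V.character (x⁻¹ * y)).re)

open scoped MonoidAlgebra Matrix ComplexConjugate ComplexOrder

/-- A matrix representation of a finite group preserves a Hermitian form, so its trace at `g⁻¹` is
conjugate to its trace at `g`. -/
theorem Matrix.trace_map_inv_eq_star {G n : Type*} [Group G] [Fintype G] [Fintype n]
    [DecidableEq n] (M : G →* Matrix n n ℂ) (g : G) :
    (M g⁻¹).trace = star (M g).trace := by
  classical
  set H : Matrix n n ℂ := ∑ h, (M h)ᴴ * M h with hH
  have hpos : H.PosDef := by
    rw [hH, ← Finset.add_sum_erase _ _ (Finset.mem_univ 1)]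
    refine Matrix.PosDef.add_posSemidef (by simpa using Matrix.PosDef.one) ?_
    exact Matrix.posSemidef_sum _ fun h _ => Matrix.posSemidef_conjTranspose_mul_self _
  have hinv : (M g)ᴴ * H * M g = H := by
    rw [hH, Finset.mul_sum, Finset.sum_mul]
    refine Fintype.sum_equiv (Equiv.mulRight g) _ _ fun h => ?_
    simp [Matrix.conjTranspose_mul, Matrix.mul_assoc]
  have hdet : IsUnit H.det := (Matrix.isUnit_iff_isUnit_det H).1 hpos.isUnit
  have hg : M g * M g⁻¹ = 1 := by rw [← map_mul]; simp
  have hconj : H * M g⁻¹ = (M g)ᴴ * H := by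
    calc H * M g⁻¹ = (M g)ᴴ * H * (M g * M g⁻¹) := by rw [← Matrix.mul_assoc, hinv]
      _ = _ := by rw [hg, mul_one]
  calc (M g⁻¹).trace = (H⁻¹ * (H * M g⁻¹)).trace := by
        rw [Matrix.nonsing_inv_mul_cancel_left _ _ hdet]
    _ = ((M g)ᴴ).trace := by
        rw [hconj, Matrix.trace_mul_comm, Matrix.mul_nonsing_inv_cancel_right _ _ hdet]
    _ = _ := Matrix.trace_conjTranspose _

theorem FDRep.character_inv_eq_conj {G : Type} [Group G] [Fintype G] (V : FDRep ℂ G) (g : G) :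
    V.character g⁻¹ = conj (V.character g) := by
  let b := Module.finBasis ℂ V
  have key := Matrix.trace_map_inv_eq_star
    ((LinearMap.toMatrixAlgEquiv b).toMulEquiv.toMonoidHom.comp V.ρ) g
  simpa [FDRep.character, LinearMap.trace_eq_matrix_trace ℂ b, LinearMap.toMatrixAlgEquiv] using key

namespace Representation

variable {G V : Type} [Group G] [AddCommGroup V] [Module ℂ V]
  [FiniteDimensional ℂ V]

theorem simple_fdRep_of_isIrreducible [Finite G] (ρ : Representation ℂ G V) [ρ.IsIrreducible] :
    Simple (FDRep.of ρ) := by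
  have := Fintype.ofFinite G
  have : Invertible (Nat.card G : ℂ) := invertibleOfNonzero (by simp)
  rw [FDRep.simple_iff_char_is_norm_one]
  have h := char_orthonormal ρ ρ
  rw [if_pos ⟨Equiv.refl ρ⟩, inv_mul_eq_iff_eq_mul₀ (by simp), mul_one] at h
  exact h

/-- By Schur's lemma, a central element of the group algebra whose trace on an irreducible
representation vanishes acts on it as zero. -/
theorem asAlgebraHom_eq_zero_of_trace_eq_zero (ρ : Representation ℂ G V) [ρ.IsIrreducible]
    {z : ℂ[G]} (hz : z ∈ Submonoid.center ℂ[G])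
    (htr : LinearMap.trace ℂ V (ρ.asAlgebraHom z) = 0) : ρ.asAlgebraHom z = 0 := by
  obtain ⟨c, hc⟩ := (IsIrreducible.algebraMap_intertwiningMap_bijective_of_isAlgClosed
    (ρ := ρ)).2 (IntertwiningMap.centralAlgebraMul ρ hz)
  have hc' : ρ.asAlgebraHom z = c • LinearMap.id := by
    ext v
    simpa [Algebra.algebraMap_eq_smul_one] using
      (congrArg (fun f : IntertwiningMap ρ ρ => f v) hc).symm
  have : Nontrivial V := IsSimpleModule.nontrivial ℂ[G] ρ.asModule
  rw [hc', map_smul, LinearMap.trace_id, smul_eq_mul, mul_eq_zero, Nat.cast_eq_zero] at htr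
  rw [hc', htr.resolve_right Module.finrank_pos.ne', zero_smul]

section OfModule

variable (M : Type) [AddCommGroup M] [Module ℂ M] [Module ℂ[G] M] [IsScalarTower ℂ ℂ[G] M]

theorem asAlgebraHom_ofModule' (z : ℂ[G]) (m : M) :
    (ofModule' (k := ℂ) (G := G) M).asAlgebraHom z m = z • m := by
  simp [asAlgebraHom_def, ofModule']

/-- The module of the representation attached to a module `M` is `M` itself. -/
noncomputable def asModuleOfModuleEquiv : (ofModule' (k := ℂ) (G := G) M).asModule ≃ₗ[ℂ[G]] M where
  __ := (ofModule' (k := ℂ) (G := G) M).asModuleEquiv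
  map_smul' z m := asAlgebraHom_ofModule' M z m

end OfModule

end Representation

/-- The irreducible characters separate class functions. -/
theorem eq_zero_of_sum_mul_character_eq_zero {G : Type} [Group G] [Fintype G] (f : G → ℂ)
    (hf : ∀ g h, f (h * g * h⁻¹) = f g)
    (h0 : ∀ W : FDRep ℂ G, Simple W → ∑ g, f g * W.character g = 0) : f = 0 := by
  classical
  set z : ℂ[G] := ∑ g, MonoidAlgebra.single g (f g) with hz
  have hcent : z ∈ Submonoid.center ℂ[G] := by
    rw [Submonoid.mem_center_iff]
    intro w
    induction w using MonoidAlgebra.induction_linear with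
    | zero => simp
    | add a b ha hb => rw [add_mul, mul_add, ha, hb]
    | single h r =>
      rw [hz, Finset.mul_sum, Finset.sum_mul]
      refine Fintype.sum_equiv (MulAut.conj h).toEquiv _ _ fun g => ?_
      simp [MonoidAlgebra.single_mul_single, hf, mul_comm r]
  have hjac : z ∈ Ring.jacobson ℂ[G] := by
    rw [Ring.jacobson, Module.jacobson, Submodule.mem_sInf]
    intro I hI
    have hsimp : IsSimpleModule ℂ[G] (ℂ[G] ⧸ I) := isSimpleModule_iff_isCoatom.2 hI
    have hfin : FiniteDimensional ℂ (ℂ[G] ⧸ I) := Module.Finite.trans ℂ[G] _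
    set ρ : Representation ℂ G (ℂ[G] ⧸ I) := Representation.ofModule' _
    have hirr := ρ.irreducible_iff_isSimpleModule_asModule.2 <|
      .congr (Representation.asModuleOfModuleEquiv (ℂ[G] ⧸ I))
    have htr : LinearMap.trace ℂ _ (ρ.asAlgebraHom z) = 0 := by
      rw [← h0 _ ρ.simple_fdRep_of_isIrreducible]
      simp [hz, map_sum, Representation.asAlgebraHom_single, FDRep.character]
    have hact := LinearMap.congr_fun (ρ.asAlgebraHom_eq_zero_of_trace_eq_zero hcent htr)
      (Submodule.Quotient.mk 1)
    rw [Representation.asAlgebraHom_ofModule'] at hact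
    simpa [← Submodule.Quotient.mk_smul] using hact
  have hz0 : z = 0 := by
    rwa [IsSemisimpleRing.jacobson_eq_bot] at hjac
  funext g
  have := congrArg (fun w : ℂ[G] => w.coeff g) hz0
  simpa [hz, Finsupp.single_apply] using this

section ClassFunctions

variable {G : Type} [Group G] [Fintype G] {ι : Type} (Φ : ι → FDRep ℂ G)

theorem sum_character_mul_character_inv [DecidableEq ι] (hsimple : ∀ i, Simple (Φ i))
    (hdistinct : ∀ i j, i ≠ j → IsEmpty (Φ i ≅ Φ j)) (i j : ι) :
    ∑ g, (Φ i).character g * (Φ j).character g⁻¹ =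
      if i = j then (Fintype.card G : ℂ) else 0 := by
  have : Invertible (Nat.card G : ℂ) := invertibleOfNonzero (by simp)
  have h := FDRep.char_orthonormal (Φ i) (Φ j)
  rw [inv_mul_eq_iff_eq_mul₀ (by simp)] at h
  rw [h, Nat.card_eq_fintype_card]
  by_cases hij : i = j
  · subst hij
    rw [if_pos ⟨Iso.refl _⟩, if_pos rfl, mul_one]
  · rw [if_neg (not_nonempty_iff.2 (hdistinct i j hij)), if_neg hij, mul_zero]

/-- Pairing trivially with a complete family of irreducible characters forces a class function to
vanish. -/
theorem eq_zero_of_forall_sum_mul_character_eq_zero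
    (hcomplete : ∀ W : FDRep ℂ G, Simple W → ∃ i, Nonempty (Φ i ≅ W)) (f : G → ℂ)
    (hf : ∀ g h, f (h * g * h⁻¹) = f g) (h0 : ∀ i, ∑ g, f g * (Φ i).character g = 0) : f = 0 := by
  refine eq_zero_of_sum_mul_character_eq_zero f hf fun W hW => ?_
  obtain ⟨i, ⟨e⟩⟩ := hcomplete W hW
  rw [← FDRep.char_iso e, h0]

/-- The character of the regular representation, as a sum of irreducible characters. -/
theorem sum_finrank_mul_character [Fintype ι] [DecidableEq G] (hsimple : ∀ i, Simple (Φ i))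
    (hdistinct : ∀ i j, i ≠ j → IsEmpty (Φ i ≅ Φ j))
    (hcomplete : ∀ W : FDRep ℂ G, Simple W → ∃ i, Nonempty (Φ i ≅ W)) (g : G) :
    ∑ i, (Module.finrank ℂ (Φ i) : ℂ) * (Φ i).character g =
      if g = 1 then (Fintype.card G : ℂ) else 0 := by
  classical
  have key := eq_zero_of_forall_sum_mul_character_eq_zero Φ hcomplete
    (fun g => (∑ i, (Module.finrank ℂ (Φ i) : ℂ) * (Φ i).character g⁻¹) -
      if g = 1 then (Fintype.card G : ℂ) else 0)
    (fun g h => by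
      have (i : ι) : (Φ i).character (h * g * h⁻¹)⁻¹ = (Φ i).character g⁻¹ := by
        rw [← (Φ i).char_conj g⁻¹ h, mul_inv_rev, mul_inv_rev, inv_inv, mul_assoc]
      simp only [this, conj_eq_one_iff])
    (fun j => by
      simp only [sub_mul, Finset.sum_sub_distrib, Finset.sum_mul, ite_mul, zero_mul,
        Finset.sum_ite_eq', Finset.mem_univ, if_true]
      rw [Finset.sum_comm]
      simp_rw [mul_assoc, ← Finset.mul_sum, mul_comm ((Φ _).character _⁻¹),
        sum_character_mul_character_inv Φ hsimple hdistinct]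
      simp [mul_comm])
  have := congrFun key g⁻¹
  simpa [sub_eq_zero] using this

end ClassFunctions

section PairCounts

variable {G : Type} [Group G] [Fintype G]

/-- The normalized number of pairs of elements of `Y` whose quotient lies in the class of `a`. -/
noncomputable def pairDensity (Y : Finset G) (a : G) : ℝ :=
  (lamConj Y a : ℝ) / ((conjCl a).card : ℝ)

theorem mem_conjCl {a b : G} : b ∈ conjCl a ↔ IsConj a b := by
  classical
  simp [conjCl]

theorem conjCl_congr {a b : G} (h : IsConj a b) : conjCl a = conjCl b := by
  ext c
  rw [mem_conjCl, mem_conjCl]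
  exact ⟨h.symm.trans, h.trans⟩

theorem card_conjCl_pos (a : G) : 0 < (conjCl a).card :=
  Finset.card_pos.2 ⟨a, mem_conjCl.2 (IsConj.refl a)⟩

open Classical in
theorem lamConj_eq_sum (Y : Finset G) (a : G) :
    lamConj Y a = ∑ x ∈ Y, ∑ y ∈ Y, if IsConj a (x⁻¹ * y) then 1 else 0 := by
  simp_rw [lamConj, Finset.card_filter, Finset.sum_product]
  congr!

theorem pairDensity_conj (Y : Finset G) (g h : G) :
    pairDensity Y (h * g * h⁻¹) = pairDensity Y g := by
  classical
  have hc : IsConj g (h * g * h⁻¹) := isConj_iff.2 ⟨h, rfl⟩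
  have hl : lamConj Y (h * g * h⁻¹) = lamConj Y g := by
    have (c : G) : IsConj (h * g * h⁻¹) c ↔ IsConj g c := ⟨hc.trans, hc.symm.trans⟩
    simp only [lamConj_eq_sum, this]
  rw [pairDensity, pairDensity, hl, conjCl_congr hc]

theorem pairDensity_one (Y : Finset G) : pairDensity Y 1 = Y.card := by
  classical
  have hc : conjCl (1 : G) = {1} := by
    ext b
    rw [mem_conjCl, isConj_one_right, Finset.mem_singleton]
  rw [pairDensity, hc, lamConj_eq_sum]
  simp only [isConj_one_right, inv_mul_eq_one]
  simp

theorem sum_sum_eq_sum_pairDensity_mul (Y : Finset G) (φ : G → ℂ)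
    (hφ : ∀ g h, φ (h * g * h⁻¹) = φ g) :
    ∑ x ∈ Y, ∑ y ∈ Y, φ (x⁻¹ * y) = ∑ g, (pairDensity Y g : ℂ) * φ g := by
  classical
  have hclass (a : G) :
      ∑ g, (if IsConj g a then φ g / ((conjCl g).card : ℂ) else 0) = φ a := by
    have hterm : ∀ g ∈ conjCl a, φ g / ((conjCl g).card : ℂ) = φ a / ((conjCl a).card : ℂ) := by
      intro g hg
      rw [mem_conjCl] at hg
      rw [conjCl_congr hg]
      obtain ⟨c, rfl⟩ := isConj_iff.1 hg
      rw [hφ]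
    have hfilter : Finset.univ.filter (fun g => IsConj g a) = conjCl a := by
      ext g
      simp only [Finset.mem_filter, Finset.mem_univ, true_and, mem_conjCl, isConj_comm]
    have hne : ((conjCl a).card : ℂ) ≠ 0 := by exact_mod_cast (card_conjCl_pos a).ne'
    rw [← Finset.sum_filter, hfilter, Finset.sum_congr rfl hterm, Finset.sum_const, nsmul_eq_mul]
    field_simp
  have hterm (g : G) : (pairDensity Y g : ℂ) * φ g =
      ∑ x ∈ Y, ∑ y ∈ Y, if IsConj g (x⁻¹ * y) then φ g / ((conjCl g).card : ℂ) else 0 := by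
    rw [pairDensity, lamConj_eq_sum]
    push_cast
    simp only [div_mul_eq_mul_div, Finset.sum_mul, Finset.sum_div, apply_ite Complex.ofReal,
      Complex.ofReal_one, Complex.ofReal_zero, ite_mul, one_mul, zero_mul, ite_div, zero_div]
  simp_rw [hterm]
  symm
  rw [Finset.sum_comm]
  refine Finset.sum_congr rfl fun x _ => ?_
  rw [Finset.sum_comm]
  exact Finset.sum_congr rfl fun y _ => hclass _

/-- Swapping the two summation variables shows that the double character sum is real. -/
theorem im_sum_sum_character_eq_zero (V : FDRep ℂ G) (Y : Finset G) :
    (∑ x ∈ Y, ∑ y ∈ Y, V.character (x⁻¹ * y)).im = 0 := by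
  rw [← Complex.conj_eq_iff_im]
  simp_rw [map_sum]
  refine Eq.trans ?_ Finset.sum_comm
  refine Finset.sum_congr rfl fun x _ => Finset.sum_congr rfl fun y _ => ?_
  rw [← FDRep.character_inv_eq_conj, mul_inv_rev, inv_inv]

end PairCounts

/-- The square roots of finitely many reals have supremum the square root of a weighted mean
exactly when all of them equal this mean. -/
theorem iSup_sqrt_eq_sqrt_mean_iff {κ : Type} [Fintype κ] [Nonempty κ] (u w : κ → ℝ) {A : ℝ}
    (hA : 0 ≤ A) (hw : ∀ i, 0 < w i) (hmean : ∑ i, w i * u i = (∑ i, w i) * A) :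
    (⨆ i, Real.sqrt (u i)) = Real.sqrt A ↔ ∀ i, u i = A := by
  constructor
  · intro h
    have hle (i : κ) : u i ≤ A := by
      rw [← Real.sqrt_le_sqrt_iff hA, ← h]
      exact le_ciSup (f := fun i => Real.sqrt (u i)) (Set.finite_range _).bddAbove i
    rw [Finset.sum_mul] at hmean
    have := (Finset.sum_eq_sum_iff_of_le fun i _ =>
      mul_le_mul_of_nonneg_left (hle i) (hw i).le).1 hmean
    exact fun i => mul_left_cancel₀ (hw i).ne' (this i (Finset.mem_univ i))
  · intro h
    simp [h]

theorem stmt7 {G : Type} [Group G] [Fintype G] [Nontrivial G]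
    (Y : Finset G) (hY : Y.Nonempty)
    -- `Φ` is a complete family of pairwise non-isomorphic irreducible representations of `G`,
    -- i.e. it enumerates the isomorphism classes of irreducible representations:
    {ι : Type} [Fintype ι] [DecidableEq ι] (Φ : ι → FDRep ℂ G)
    (hsimple : ∀ i, Simple (Φ i))
    (hdistinct : ∀ i j, i ≠ j → IsEmpty (Φ i ≅ Φ j))
    (hcomplete : ∀ W : FDRep ℂ G, Simple W → ∃ i, Nonempty (Φ i ≅ W))
    -- `i₀` is the index of the trivial representation `1_G`:
    (i₀ : ι) (hi₀ : ∀ g : G, (Φ i₀).character g = 1) :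
    -- `Y` is a pre-difference set iff `D(Y)` attains the lower bound:
    (∃ c : ℝ, ∀ a : G, a ≠ 1 → (lamConj Y a : ℝ) / ((conjCl a).card : ℝ) = c) ↔
      (⨆ i : {i : ι // i ≠ i₀}, dPar (Φ i) Y / (Module.finrank ℂ (Φ i) : ℝ)) =
        Real.sqrt ((1 / (Y.card : ℝ) - 1 / (Fintype.card G : ℝ)) /
          ((Fintype.card G : ℝ) - 1)) := by
  classical
  set N : ℝ := (Fintype.card G : ℝ) with hN
  set n : ℝ := (Y.card : ℝ) with hn
  have hN1 : 1 < N := by rw [hN]; exact_mod_cast Fintype.one_lt_card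
  have hn0 : 0 < n := by rw [hn]; exact_mod_cast hY.card_pos
  have hnN : n ≤ N := by rw [hn, hN]; exact_mod_cast Finset.card_le_univ Y
  set d : ι → ℝ := fun i => (Module.finrank ℂ (Φ i) : ℝ) with hd
  have hreg := sum_finrank_mul_character Φ hsimple hdistinct hcomplete
  have horth := sum_character_mul_character_inv Φ hsimple hdistinct
  have hd0 (i : ι) : 0 < d i := by
    rw [hd]
    refine Nat.cast_pos.2 (Nat.pos_of_ne_zero fun h => ?_)
    have : Module.finrank ℂ (Φ i) = 0 := h
    have hzero (g : G) : (Φ i).character g = 0 := by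
      have := Module.finrank_zero_iff.1 this
      rw [FDRep.character, Subsingleton.elim ((Φ i).ρ g) 0, map_zero]
    simpa [hzero, eq_comm] using horth i i
  have hd1 : d i₀ = 1 := by
    have := hi₀ 1
    rw [FDRep.char_one] at this
    simp only [hd]
    exact_mod_cast this
  set S : ι → ℝ := fun i => (∑ x ∈ Y, ∑ y ∈ Y, (Φ i).character (x⁻¹ * y)).re with hS
  have hSF (i : ι) : (S i : ℂ) = ∑ g, (pairDensity Y g : ℂ) * (Φ i).character g := by
    rw [← sum_sum_eq_sum_pairDensity_mul Y _ (FDRep.char_conj (Φ i))]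
    exact Complex.ext rfl (im_sum_sum_character_eq_zero _ _).symm
  have hS0 : S i₀ = n ^ 2 := by
    simp [hS, hi₀, hn, sq]
  have hsumS : ∑ i, d i * S i = N * n := by
    have : ((∑ i, d i * S i : ℝ) : ℂ) = ((N * n : ℝ) : ℂ) := by
      push_cast
      simp_rw [hSF, Finset.mul_sum]
      rw [Finset.sum_comm]
      calc _ = ∑ g, (pairDensity Y g : ℂ) *
            ∑ i, (Module.finrank ℂ (Φ i) : ℂ) * (Φ i).character g := by
            simp [Finset.mul_sum, hd, mul_left_comm]
        _ = _ := by
            simp_rw [hreg]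
            simp [pairDensity_one, hN, hn, mul_comm]
    exact_mod_cast this
  have hsumd : ∑ i, d i ^ 2 = N := by
    have := hreg 1
    simp only [FDRep.char_one, if_true] at this
    simp only [hd, hN, sq]
    exact_mod_cast this
  have hsub (f : ι → ℝ) : ∑ i : {i : ι // i ≠ i₀}, f i = ∑ i, f i - f i₀ := by
    rw [← Finset.sum_erase_eq_sub (Finset.mem_univ i₀)]
    exact (Finset.sum_subtype _ (by simp) f).symm
  set A : ℝ := (1 / n - 1 / N) / (N - 1) with hA
  have hA0 : 0 ≤ A :=
    div_nonneg (sub_nonneg.2 (one_div_le_one_div_of_le hn0 hnN)) (by linarith)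
  set u : ι → ℝ := fun i => S i / (d i * (n ^ 2 * N)) with hu
  have hweights : ∑ i : {i : ι // i ≠ i₀}, d i ^ 2 = N - 1 := by
    rw [hsub fun i => d i ^ 2, hsumd, hd1, one_pow]
  have hnonempty : Nonempty {i : ι // i ≠ i₀} := by
    by_contra hempty
    rw [not_nonempty_iff] at hempty
    rw [Finset.univ_eq_empty, Finset.sum_empty] at hweights
    linarith
  have hmean : ∑ i : {i : ι // i ≠ i₀}, d i ^ 2 * u i =
      (∑ i : {i : ι // i ≠ i₀}, d i ^ 2) * A := by
    have hterm (i : ι) : d i ^ 2 * u i = d i * S i / (n ^ 2 * N) := by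
      have := hd0 i
      simp only [hu]
      field_simp
    rw [hsub fun i => d i ^ 2 * u i, hweights]
    simp_rw [hterm]
    rw [← Finset.sum_div, hsumS, hd1, hS0, hA]
    have : N - 1 ≠ 0 := by linarith
    field_simp
  have hpar (i : ι) : dPar (Φ i) Y / (Module.finrank ℂ (Φ i) : ℝ) = Real.sqrt (u i) := by
    have h := hd0 i
    change Real.sqrt (d i / (n ^ 2 * N) * S i) / d i = _
    nth_rw 2 [← Real.sqrt_sq h.le]
    rw [← Real.sqrt_div' _ (sq_nonneg _)]
    congr 1
    simp only [hu]
    field_simp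
  simp_rw [hpar]
  rw [iSup_sqrt_eq_sqrt_mean_iff (fun i : {i : ι // i ≠ i₀} => u i)
    (fun i : {i : ι // i ≠ i₀} => d i ^ 2) hA0 (fun i => pow_pos (hd0 i) 2) hmean]
  have hsumchar (i : ι) (hi : i ≠ i₀) : ∑ g, (Φ i).character g = 0 := by
    simpa [hi₀, hi] using horth i i₀
  change (∃ c : ℝ, ∀ a : G, a ≠ 1 → pairDensity Y a = c) ↔ _
  constructor
  · rintro ⟨c, hc⟩
    have hF (g : G) : (pairDensity Y g : ℂ) = c + if g = 1 then (n - c : ℂ) else 0 := by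
      split_ifs with hg
      · rw [hg, pairDensity_one]; simp [hn]
      · rw [hc g hg, add_zero]
    have hconst (i : {i : ι // i ≠ i₀}) : u i = (n - c) / (n ^ 2 * N) := by
      have hSi : S i = (n - c) * d i := by
        have := hSF i
        simp only [hF, add_mul, Finset.sum_add_distrib, ← Finset.mul_sum, hsumchar i i.2,
          ite_mul, zero_mul, Finset.sum_ite_eq', Finset.mem_univ, if_true, FDRep.char_one,
          mul_zero, zero_add] at this
        simp only [hd]
        exact_mod_cast this
      have := hd0 i
      simp only [hu, hSi]
      field_simp
    simp_rw [hconst, ← Finset.sum_mul] at hmean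
    rw [hweights] at hmean
    intro i
    rw [hconst]
    exact mul_left_cancel₀ (by linarith : N - 1 ≠ 0) hmean
  · intro h
    set D : ℝ := A * (n ^ 2 * N) with hD
    have hSi (i : ι) (hi : i ≠ i₀) : S i = D * d i := by
      have h1 := h ⟨i, hi⟩
      have := hd0 i
      simp only [hu] at h1
      rw [div_eq_iff (by positivity)] at h1
      rw [h1, hD]
      ring
    refine ⟨(n ^ 2 - D) / N, fun a ha => ?_⟩
    have hNC : (N : ℂ) ≠ 0 := by exact_mod_cast (by linarith : N ≠ 0)
    have key := eq_zero_of_forall_sum_mul_character_eq_zero Φ hcomplete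
      (fun g => (pairDensity Y g : ℂ) - ((n ^ 2 - D) / N : ℂ) - if g = 1 then (D : ℂ) else 0)
      (fun g k => by simp only [pairDensity_conj, conj_eq_one_iff])
      (fun i => by
        simp only [sub_mul, Finset.sum_sub_distrib, ← hSF, ← Finset.mul_sum, ite_mul, zero_mul,
          Finset.sum_ite_eq', Finset.mem_univ, if_true, FDRep.char_one]
        by_cases hi : i = i₀
        · have h1 : (Module.finrank ℂ (Φ i₀) : ℂ) = 1 := by
            rw [← FDRep.char_one, hi₀]
          have h2 : ∑ _g : G, (1 : ℂ) = N := by simp [hN]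
          subst hi
          simp only [hi₀, h1, h2, hS0]
          push_cast
          field_simp
          ring
        · rw [hsumchar i hi, hSi i hi]
          simp [hd])
    have := congrFun key a
    simp only [ha, if_false, sub_zero, Pi.zero_apply, sub_eq_zero] at this
    exact_mod_cast this
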